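/- The Gauss hypergeometric series satisfies ₂F₁(1/24, 13/24; 5/6; 138240/152881) = (1/5) · √2 · √3 · 5^{1/6} · 17^{1/12} · 23^{1/12}. -/

import Mathlib

open scoped Nat

/-- Pochhammer symbol (rising factorial) on the reals. -/
noncomputable def poch (a : ℝ) (n : ℕ) : ℝ := ∏ i ∈ Finset.range n, (a + i)

/-- Gauss hypergeometric series ₂F₁(a,b;c;x) as a real series. -/
noncomputable def twoFone (a b c x : ℝ) : ℝ :=
  ∑' n : ℕ, poch a n * poch b n / (poch c n * (n ! : ℝ)) * x ^ n

/-- complex power series with real coefficients -/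
noncomputable def serC (u : ℕ → ℝ) (z : ℂ) : ℂ := ∑' n : ℕ, (u n : ℂ) * z ^ n

/-- coefficients of the derivative -/
noncomputable def dco (u : ℕ → ℝ) (n : ℕ) : ℝ := ((n : ℝ) + 1) * u (n + 1)

/-- polynomial growth -/
def PolyGr (u : ℕ → ℝ) : Prop := ∃ (C : ℝ) (k : ℕ), 0 ≤ C ∧ ∀ n, |u n| ≤ C * ((n : ℝ) + 1) ^ k

lemma PolyGr.dco {u : ℕ → ℝ} (h : PolyGr u) : PolyGr (dco u) := by
  obtain ⟨C, k, hC, h⟩ := h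
  refine ⟨C * 2 ^ k, k + 1, by positivity, fun n => ?_⟩
  have h1 := h (n + 1)
  have h2 : |_root_.dco u n| = ((n : ℝ) + 1) * |u (n + 1)| := by
    unfold _root_.dco
    rw [abs_mul, abs_of_nonneg (by positivity)]
  rw [h2]
  push_cast at h1
  have h3 : ((n : ℝ) + 1 + 1) ^ k ≤ (2 * ((n : ℝ) + 1)) ^ k := by
    gcongr
    have : (0 : ℝ) ≤ n := by positivity
    linarith
  calc ((n : ℝ) + 1) * |u (n + 1)| ≤ ((n : ℝ) + 1) * (C * (2 * ((n : ℝ) + 1)) ^ k) := by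
        gcongr
        exact h1.trans (by gcongr)
    _ = _ := by rw [mul_pow]; ring

lemma PolyGr.summable {u : ℕ → ℝ} (h : PolyGr u) {r : ℝ} (hr0 : 0 ≤ r) (hr : r < 1) :
    Summable (fun n => |u n| * r ^ n) := by
  obtain ⟨C, k, hC, h⟩ := h
  have h1 : Summable (fun n : ℕ => (((n : ℝ)) ^ k * r ^ n)) :=
    summable_pow_mul_geometric_of_norm_lt_one k (by rwa [Real.norm_of_nonneg hr0])
  have h0 : Summable (fun n : ℕ => r ^ n) := summable_geometric_of_lt_one hr0 hr
  have h2 : Summable (fun n : ℕ => C * 2 ^ k * (((n : ℝ)) ^ k * r ^ n) + C * 2 ^ k * r ^ n) :=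
    (h1.mul_left _).add (h0.mul_left _)
  refine Summable.of_nonneg_of_le (fun n => by positivity) (fun n => ?_) h2
  have h4 : ((n : ℝ) + 1) ^ k ≤ 2 ^ k * ((n : ℝ) ^ k + 1) := by
    rcases Nat.eq_zero_or_pos n with hn | hn
    · subst hn
      have : (1 : ℝ) ≤ 2 ^ k := one_le_pow₀ (by norm_num)
      have h0' : (0 : ℝ) ≤ (0 : ℝ) ^ k := by positivity
      simp
      nlinarith
    · have hn' : (1 : ℝ) ≤ n := by exact_mod_cast hn
      calc ((n : ℝ) + 1) ^ k ≤ (2 * (n : ℝ)) ^ k := by gcongr; linarith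
        _ = 2 ^ k * (n : ℝ) ^ k := mul_pow _ _ _
        _ ≤ _ := by gcongr; linarith
  calc |u n| * r ^ n ≤ (C * (2 ^ k * ((n : ℝ) ^ k + 1))) * r ^ n := by
        gcongr
        exact (h n).trans (by gcongr)
    _ = _ := by ring

lemma PolyGr.summableC {u : ℕ → ℝ} (h : PolyGr u) {z : ℂ} (hz : ‖z‖ < 1) :
    Summable (fun n => (u n : ℂ) * z ^ n) := by
  refine Summable.of_norm ?_
  simpa using h.summable (norm_nonneg z) hz

lemma serC_hasDerivAt {u : ℕ → ℝ} (h : PolyGr u) {z : ℂ} (hz : ‖z‖ < 1) :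
    HasDerivAt (serC u) (serC (dco u) z) z := by
  obtain ⟨r, hr1, hr2⟩ := exists_between hz
  have hr0 : 0 ≤ r := (norm_nonneg z).trans hr1.le
  have key := hasDerivAt_tsum_of_isPreconnected (𝕜 := ℂ) (F := ℂ)
    (g := fun (n : ℕ) (z : ℂ) => (u n : ℂ) * z ^ n)
    (g' := fun (n : ℕ) (z : ℂ) => (u n : ℂ) * ((n : ℂ) * z ^ (n - 1)))
    (u := fun n : ℕ => |u n| * (n * r ^ (n - 1))) (t := Metric.ball 0 r) (y₀ := 0) (y := z)
    ?_ Metric.isOpen_ball (convex_ball _ _).isPreconnected ?_ ?_ ?_ ?_ ?_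
  · have hs : Summable (fun n : ℕ => (u n : ℂ) * ((n : ℂ) * z ^ (n - 1))) := by
      rw [← summable_nat_add_iff 1]
      refine (h.dco.summableC hz).congr fun n => ?_
      simp [dco]; ring
    have e : serC (dco u) z = ∑' n : ℕ, (u n : ℂ) * ((n : ℂ) * z ^ (n - 1)) := by
      rw [hs.tsum_eq_zero_add]
      unfold serC
      simp only [Nat.cast_zero, zero_mul, mul_zero, zero_add]
      refine tsum_congr fun n => ?_
      simp [dco]; ring
    rw [e]
    exact key
  · rw [← summable_nat_add_iff 1]
    refine (h.dco.summable hr0 hr2).congr fun n => ?_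
    simp only [dco, abs_mul]
    rw [abs_of_nonneg (by positivity : (0 : ℝ) ≤ (n : ℝ) + 1)]
    simp; ring
  · intro n y _
    exact (hasDerivAt_pow n y).const_mul _
  · intro n y hy
    have hy' : ‖y‖ ≤ r := by simpa using (Metric.mem_ball.1 hy).le
    simp only [norm_mul, norm_pow, Complex.norm_real, Complex.norm_natCast, Real.norm_eq_abs]
    gcongr
  · simp; exact (norm_nonneg z).trans_lt hr1
  · refine h.summableC (by simp)
  · simpa using hr1

lemma serC_mul_dco {u : ℕ → ℝ} (h : PolyGr u) {z : ℂ} (hz : ‖z‖ < 1) :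
    HasSum (fun n : ℕ => ((n * u n : ℝ) : ℂ) * z ^ n) (z * serC (dco u) z) := by
  rw [← hasSum_nat_add_iff' 1]
  have := (h.dco.summableC hz).hasSum.mul_left z
  have e : (fun n : ℕ => (((n + 1 : ℕ) * u (n + 1) : ℝ) : ℂ) * z ^ (n + 1))
      = fun n => z * ((dco u n : ℂ) * z ^ n) := by
    funext n; simp [dco]; ring
  rw [e]
  simpa [serC] using this

lemma serC_ode {u : ℕ → ℝ} (h : PolyGr u) {a b c : ℝ}
    (hu : ∀ n : ℕ, ((n : ℝ) + 1) * (n + c) * u (n + 1) = (n + a) * (n + b) * u n)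
    {z : ℂ} (hz : ‖z‖ < 1) :
    z * (1 - z) * serC (dco (dco u)) z + (c - (a + b + 1) * z) * serC (dco u) z
      - a * b * serC u z = 0 := by
  have h0 : HasSum (fun n : ℕ => (u n : ℂ) * z ^ n) (serC u z) := (h.summableC hz).hasSum
  have h1 : HasSum (fun n : ℕ => (dco u n : ℂ) * z ^ n) (serC (dco u) z) :=
    (h.dco.summableC hz).hasSum
  have h2 := serC_mul_dco h hz
  have h3 := serC_mul_dco h.dco hz
  have h4 : HasSum (fun n : ℕ => ((n * (n - 1) * u n : ℝ) : ℂ) * z ^ n)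
      (z * (z * serC (dco (dco u)) z)) := by
    rw [← hasSum_nat_add_iff' 1]
    have e : (fun n : ℕ => (((n + 1 : ℕ) * ((n + 1 : ℕ) - 1) * u (n + 1) : ℝ) : ℂ) * z ^ (n + 1))
        = fun n => z * (((n * dco u n : ℝ) : ℂ) * z ^ n) := by
      funext n; simp [dco]; ring
    rw [e]
    simpa using h3.mul_left z
  have h5 := (((h3.sub h4).add (h1.mul_left (c : ℂ))).sub (h2.mul_left ((a : ℂ) + b + 1))).sub
    (h0.mul_left ((a : ℂ) * b))
  have e : (fun n : ℕ => ((n * dco u n : ℝ) : ℂ) * z ^ n - ((n * (n - 1) * u n : ℝ) : ℂ) * z ^ n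
      + (c : ℂ) * ((dco u n : ℂ) * z ^ n) - ((a : ℂ) + b + 1) * (((n * u n : ℝ) : ℂ) * z ^ n)
      - (a : ℂ) * b * ((u n : ℂ) * z ^ n)) = fun _ => 0 := by
    funext n
    have := congrArg (fun x : ℝ => (x : ℂ)) (hu n)
    push_cast at this
    simp only [dco]
    push_cast
    linear_combination z ^ n * this
  rw [e] at h5
  have h7 := h5.unique hasSum_zero
  linear_combination h7

/-- hypergeometric coefficients -/
noncomputable def hco (a b c : ℝ) (n : ℕ) : ℝ := poch a n * poch b n / (poch c n * (n ! : ℝ))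

lemma poch_pos {a : ℝ} (ha : 0 < a) (n : ℕ) : 0 < poch a n := by
  unfold poch
  exact Finset.prod_pos fun i _ => by positivity

lemma hco_pos {a b c : ℝ} (ha : 0 < a) (hb : 0 < b) (hc : 0 < c) (n : ℕ) : 0 < hco a b c n := by
  have := poch_pos ha n
  have := poch_pos hb n
  have := poch_pos hc n
  unfold hco
  positivity

lemma hco_zero (a b c : ℝ) : hco a b c 0 = 1 := by simp [hco, poch]

lemma hco_succ {a b c : ℝ} (hc : 0 < c) (n : ℕ) :
    ((n : ℝ) + 1) * (n + c) * hco a b c (n + 1) = (n + a) * (n + b) * hco a b c n := by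
  have h1 := poch_pos hc n
  have h2 : (0 : ℝ) < (n ! : ℝ) := by positivity
  have h3 : (0 : ℝ) < (n : ℝ) + 1 := by positivity
  have h4 : (0 : ℝ) < c + n := by positivity
  have e : ∀ x, poch x (n + 1) = poch x n * (x + n) := fun x => Finset.prod_range_succ _ _
  unfold hco
  rw [e, e, e, Nat.factorial_succ]
  push_cast
  field_simp
  ring

lemma hco_summable {a b c κ : ℝ} (ha : 0 < a) (hb : 0 < b) (hc : 0 < c) (hκ : 0 < κ)
    (h1 : κ ≤ c - a - b) (h3 : κ * c + a * b ≤ c - a - b - κ) :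
    Summable (hco a b c) := by
  rw [← summable_nat_add_iff 1]
  refine summable_of_sum_range_le (c := hco a b c 1 / κ)
    (fun n => (hco_pos ha hb hc _).le) (fun N => ?_)
  rw [le_div_iff₀ hκ]
  have key : ∀ N : ℕ, (∑ i ∈ Finset.range N, hco a b c (i + 1)) * κ
      + ((N : ℝ) + 1) * hco a b c (N + 1) ≤ hco a b c 1 := by
    intro N
    induction N with
    | zero => simp
    | succ n ih =>
      rw [Finset.sum_range_succ]
      have hs := hco_succ (a := a) (b := b) hc (n + 1)
      have hp := hco_pos ha hb hc (n + 1)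
      have hq := hco_pos ha hb hc (n + 1 + 1)
      push_cast at hs ⊢
      set x : ℝ := (n : ℝ) with hx
      have hx0 : 0 ≤ x := by positivity
      have hD : 0 < x + 1 + c := by positivity
      have : (x + 1 + 1) * hco a b c (n + 1 + 1) ≤ (x + 1 - κ) * hco a b c (n + 1) := by
        rw [← mul_le_mul_iff_right₀ hD]
        calc (x + 1 + c) * ((x + 1 + 1) * hco a b c (n + 1 + 1))
            = (x + 1 + a) * (x + 1 + b) * hco a b c (n + 1) := by rw [← hs]; ring
          _ ≤ ((x + 1 + c) * (x + 1 - κ)) * hco a b c (n + 1) := by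
              refine mul_le_mul_of_nonneg_right ?_ hp.le
              nlinarith [mul_nonneg hx0 (sub_nonneg.2 h1)]
          _ = _ := by ring
      linarith
  have := key N
  have : 0 ≤ ((N : ℝ) + 1) * hco a b c (N + 1) :=
    mul_nonneg (by positivity) (hco_pos ha hb hc _).le
  linarith

lemma polyGr_of_summable {u : ℕ → ℝ} (h : Summable u) (hp : ∀ n, 0 < u n) : PolyGr u := by
  refine ⟨∑' n, u n, 0, tsum_nonneg fun n => (hp n).le, fun n => ?_⟩
  rw [abs_of_pos (hp n)]
  simpa using h.le_tsum n fun m _ => (hp m).le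

lemma serC_continuousOn {u : ℕ → ℝ} (h : Summable u) (hp : ∀ n, 0 < u n) :
    ContinuousOn (serC u) (Metric.closedBall 0 1) := by
  refine continuousOn_tsum (u := u) (fun n => by fun_prop) h (fun n z hz => ?_)
  have hz' : ‖z‖ ≤ 1 := by simpa using hz
  rw [norm_mul, norm_pow, Complex.norm_real, Real.norm_of_nonneg (hp n).le]
  exact mul_le_of_le_one_right (hp n).le (pow_le_one₀ (norm_nonneg _) hz')

lemma serC_real (u : ℕ → ℝ) (x : ℝ) : serC u (x : ℂ) = ((∑' n, u n * x ^ n : ℝ) : ℂ) := by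
  unfold serC
  rw [Complex.ofReal_tsum]
  push_cast
  rfl

/-- quadratic polynomial R -/
noncomputable def Rq (y : ℂ) : ℂ := 76 * y ^ 2 + 117 * y + 816
/-- quadratic polynomial S -/
noncomputable def Sq (y : ℂ) : ℂ := y ^ 2 + 384
/-- the pullback map -/
noncomputable def fz (y : ℂ) : ℂ := 3375 * (y - 4) ^ 6 / (Rq y ^ 2 * Sq y)
/-- its derivative -/
noncomputable def fz1 (y : ℂ) : ℂ :=
  20250 * (y - 4) ^ 5 * (72 + 7 * y) ^ 3 / (Rq y ^ 3 * Sq y ^ 2)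
/-- its second derivative -/
noncomputable def fz2 (y : ℂ) : ℂ :=
  20250 * (y - 4) ^ 4 * (72 + 7 * y) ^ 2 *
    (5 * (72 + 7 * y) * Rq y * Sq y + 21 * (y - 4) * Rq y * Sq y
      - 3 * (y - 4) * (72 + 7 * y) * (152 * y + 117) * Sq y
      - 2 * (y - 4) * (72 + 7 * y) * Rq y * (2 * y)) / (Rq y ^ 4 * Sq y ^ 3)
/-- algebraic prefactor -/
noncomputable def hh (e y : ℂ) : ℂ := Rq y ^ (-2 * e) * Sq y ^ (-e)
/-- log derivative of the prefactor -/
noncomputable def kk (e y : ℂ) : ℂ := -2 * e * (152 * y + 117) / Rq y - e * (2 * y) / Sq y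
/-- derivative of kk -/
noncomputable def kk1 (e y : ℂ) : ℂ :=
  -2 * e * (152 * Rq y - (152 * y + 117) ^ 2) / Rq y ^ 2 - e * (2 * Sq y - (2 * y) ^ 2) / Sq y ^ 2

/-- good points -/
def Good (y : ℂ) : Prop := Rq y ∈ Complex.slitPlane ∧ Sq y ∈ Complex.slitPlane ∧ ‖fz y‖ < 1

lemma Rq_deriv (y : ℂ) : HasDerivAt Rq (152 * y + 117) y := by
  have h := (((hasDerivAt_pow 2 y).const_mul 76).add ((hasDerivAt_id y).const_mul 117)).add_const 816
  have h2 : HasDerivAt Rq _ y := h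
  convert! h2 using 1
  push_cast; ring

lemma Sq_deriv (y : ℂ) : HasDerivAt Sq (2 * y) y := by
  have h := (hasDerivAt_pow 2 y).add_const 384
  have h2 : HasDerivAt Sq _ y := h
  convert! h2 using 1
  push_cast; ring

lemma hh_deriv (e : ℂ) {y : ℂ} (h1 : Rq y ∈ Complex.slitPlane) (h2 : Sq y ∈ Complex.slitPlane) :
    HasDerivAt (hh e) (hh e y * kk e y) y := by
  have hR := Complex.slitPlane_ne_zero h1
  have hS := Complex.slitPlane_ne_zero h2
  have h := ((Rq_deriv y).cpow_const (c := -2 * e) h1).mul ((Sq_deriv y).cpow_const (c := -e) h2)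
  have h3 : HasDerivAt (hh e) _ y := h
  convert! h3 using 1
  rw [Complex.cpow_sub _ _ hR, Complex.cpow_sub _ _ hS, Complex.cpow_one, Complex.cpow_one]
  unfold hh kk
  field_simp
  ring

lemma kk_deriv (e : ℂ) {y : ℂ} (hR : Rq y ≠ 0) (hS : Sq y ≠ 0) :
    HasDerivAt (kk e) (kk1 e y) y := by
  have a1 : HasDerivAt (fun y : ℂ => -2 * e * (152 * y + 117)) (-2 * e * 152) y := by
    simpa using (((hasDerivAt_id y).const_mul 152).add_const 117).const_mul (-2 * e)
  have a2 : HasDerivAt (fun y : ℂ => e * (2 * y)) (e * 2) y := by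
    simpa using ((hasDerivAt_id y).const_mul 2).const_mul e
  have h3 : HasDerivAt (kk e) _ y := (a1.div (Rq_deriv y) hR).sub (a2.div (Sq_deriv y) hS)
  convert! h3 using 1
  unfold kk1
  field_simp
  ring

lemma fz_deriv {y : ℂ} (hR : Rq y ≠ 0) (hS : Sq y ≠ 0) : HasDerivAt fz (fz1 y) y := by
  have a1 : HasDerivAt (fun y : ℂ => 3375 * (y - 4) ^ 6) (3375 * (6 * (y - 4) ^ 5)) y := by
    simpa using ((((hasDerivAt_id y).sub_const 4).pow 6).const_mul 3375)
  have a2 := ((Rq_deriv y).pow 2).mul (Sq_deriv y)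
  have h3 : HasDerivAt fz _ y := a1.div a2 (mul_ne_zero (pow_ne_zero 2 hR) hS)
  convert! h3 using 1
  unfold fz1
  simp only [Pi.pow_apply]
  field_simp
  simp only [Rq, Sq]
  push_cast
  ring

lemma fz1_deriv {y : ℂ} (hR : Rq y ≠ 0) (hS : Sq y ≠ 0) : HasDerivAt fz1 (fz2 y) y := by
  have a0 : HasDerivAt (fun y : ℂ => 72 + 7 * y) 7 y := by
    simpa using ((hasDerivAt_id y).const_mul 7).const_add 72
  have a1 : HasDerivAt (fun y : ℂ => 20250 * (y - 4) ^ 5) (20250 * (5 * (y - 4) ^ 4)) y := by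
    simpa using ((((hasDerivAt_id y).sub_const 4).pow 5).const_mul 20250)
  have a2 := ((Rq_deriv y).pow 3).mul ((Sq_deriv y).pow 2)
  have h3 : HasDerivAt fz1 _ y :=
    (a1.mul (a0.pow 3)).div a2 (mul_ne_zero (pow_ne_zero 3 hR) (pow_ne_zero 2 hS))
  convert! h3 using 1
  unfold fz2
  simp only [Pi.mul_apply, Pi.pow_apply]
  field_simp
  push_cast
  ring

lemma dgen {h a b f F F1 : ℂ → ℂ} {y k a' b' f' F2v : ℂ}
    (hh : HasDerivAt h (h y * k) y) (ha : HasDerivAt a a' y) (hb : HasDerivAt b b' y)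
    (hf : HasDerivAt f f' y) (hF : HasDerivAt F (F1 (f y)) (f y))
    (hF1 : HasDerivAt F1 F2v (f y)) :
    HasDerivAt (fun y => h y * (a y * F (f y) + b y * F1 (f y)))
      (h y * ((k * a y + a') * F (f y) + (k * b y + b' + a y * f') * F1 (f y)
        + b y * f' * F2v)) y := by
  have hFf : HasDerivAt (fun y => F (f y)) (F1 (f y) * f') y := hF.comp y hf
  have hFf1 : HasDerivAt (fun y => F1 (f y)) (F2v * f') y := hF1.comp y hf
  have := hh.mul ((ha.mul hFf).add (hb.mul hFf1))
  convert! this using 1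
  simp only [Pi.mul_apply, Pi.add_apply]
  ring

/-- first solution and derivatives -/
noncomputable def Y0 (u : ℕ → ℝ) (y : ℂ) : ℂ :=
  hh (1/24) y * (1 * serC u (fz y) + 0 * serC (dco u) (fz y))
/-- first derivative -/
noncomputable def Y1 (u : ℕ → ℝ) (y : ℂ) : ℂ :=
  hh (1/24) y * (kk (1/24) y * serC u (fz y) + fz1 y * serC (dco u) (fz y))
/-- second derivative -/
noncomputable def Y2 (u : ℕ → ℝ) (y : ℂ) : ℂ :=
  hh (1/24) y * ((kk (1/24) y * kk (1/24) y + kk1 (1/24) y) * serC u (fz y)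
    + (kk (1/24) y * fz1 y + fz2 y + kk (1/24) y * fz1 y) * serC (dco u) (fz y)
    + fz1 y * fz1 y * serC (dco (dco u)) (fz y))
/-- second solution and derivatives -/
noncomputable def Z0 (u : ℕ → ℝ) (y : ℂ) : ℂ :=
  hh (5/24) y * ((4 - y) * serC u (fz y) + 0 * serC (dco u) (fz y))
/-- first derivative -/
noncomputable def Z1 (u : ℕ → ℝ) (y : ℂ) : ℂ :=
  hh (5/24) y * ((kk (5/24) y * (4 - y) - 1) * serC u (fz y)
    + ((4 - y) * fz1 y) * serC (dco u) (fz y))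
/-- second derivative -/
noncomputable def Z2 (u : ℕ → ℝ) (y : ℂ) : ℂ :=
  hh (5/24) y * ((kk (5/24) y * (kk (5/24) y * (4 - y) - 1)
      + (kk1 (5/24) y * (4 - y) - kk (5/24) y)) * serC u (fz y)
    + (kk (5/24) y * ((4 - y) * fz1 y) + ((4 - y) * fz2 y - fz1 y)
      + (kk (5/24) y * (4 - y) - 1) * fz1 y) * serC (dco u) (fz y)
    + ((4 - y) * fz1 y) * fz1 y * serC (dco (dco u)) (fz y))

section
variable {u : ℕ → ℝ} (hu : PolyGr u) {y : ℂ} (hy : Good y)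

lemma Y0_deriv (hu : PolyGr u) (hy : Good y) : HasDerivAt (Y0 u) (Y1 u y) y := by
  have hR := Complex.slitPlane_ne_zero hy.1
  have hS := Complex.slitPlane_ne_zero hy.2.1
  have := dgen (hh_deriv (1/24) hy.1 hy.2.1) (hasDerivAt_const y (1 : ℂ))
    (hasDerivAt_const y (0 : ℂ)) (fz_deriv hR hS) (serC_hasDerivAt hu hy.2.2)
    (serC_hasDerivAt hu.dco hy.2.2)
  have h3 : HasDerivAt (Y0 u) _ y := this
  convert! h3 using 1
  unfold Y1
  ring

lemma Y1_deriv (hu : PolyGr u) (hy : Good y) : HasDerivAt (Y1 u) (Y2 u y) y := by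
  have hR := Complex.slitPlane_ne_zero hy.1
  have hS := Complex.slitPlane_ne_zero hy.2.1
  exact dgen (hh_deriv (1/24) hy.1 hy.2.1) (kk_deriv (1/24) hR hS)
    (fz1_deriv hR hS) (fz_deriv hR hS) (serC_hasDerivAt hu hy.2.2)
    (serC_hasDerivAt hu.dco hy.2.2)

lemma lin_deriv (y : ℂ) : HasDerivAt (fun y : ℂ => 4 - y) (-1) y := by
  simpa using (hasDerivAt_id y).const_sub 4

lemma Z0_deriv (hu : PolyGr u) (hy : Good y) : HasDerivAt (Z0 u) (Z1 u y) y := by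
  have hR := Complex.slitPlane_ne_zero hy.1
  have hS := Complex.slitPlane_ne_zero hy.2.1
  have := dgen (hh_deriv (5/24) hy.1 hy.2.1) (lin_deriv y)
    (hasDerivAt_const y (0 : ℂ)) (fz_deriv hR hS) (serC_hasDerivAt hu hy.2.2)
    (serC_hasDerivAt hu.dco hy.2.2)
  have h3 : HasDerivAt (Z0 u) _ y := this
  convert! h3 using 1
  unfold Z1
  ring

lemma Z1_deriv (hu : PolyGr u) (hy : Good y) : HasDerivAt (Z1 u) (Z2 u y) y := by
  have hR := Complex.slitPlane_ne_zero hy.1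
  have hS := Complex.slitPlane_ne_zero hy.2.1
  have := dgen (hh_deriv (5/24) hy.1 hy.2.1)
    (((kk_deriv (5/24) hR hS).mul (lin_deriv y)).sub_const 1)
    ((lin_deriv y).mul (fz1_deriv hR hS)) (fz_deriv hR hS) (serC_hasDerivAt hu hy.2.2)
    (serC_hasDerivAt hu.dco hy.2.2)
  have h3 : HasDerivAt (Z1 u) _ y := this
  convert! h3 using 1
  unfold Z2
  simp only [Pi.mul_apply]
  ring

end

/-- the operator -/
noncomputable def Lop (y g g1 g2 : ℂ) : ℂ :=
  (y ^ 2 + 9) * (y ^ 2 + 384) * g2 + (3/2 * y * (y ^ 2 + 384) + y * (y ^ 2 + 9)) * g1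
    + (5/16 * y ^ 2 + 135/4) * g

lemma I2 {y : ℂ} (hR : Rq y ≠ 0) (hS : Sq y ≠ 0) :
    (y ^ 2 + 9) * (y ^ 2 + 384) * (fz1 y * fz1 y) =
    (121500 * (y - 4) ^ 4 * (72 + 7 * y) ^ 2 / (Rq y ^ 2 * Sq y)) * (fz y * (1 - fz y)) := by
  have e : 1 - fz y = (y ^ 2 + 9) * (72 + 7 * y) ^ 4 / (Rq y ^ 2 * Sq y) := by
    unfold fz
    field_simp
    simp only [Rq, Sq]
    ring
  have e2 : y ^ 2 + 384 = Sq y := rfl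
  rw [e, e2]
  unfold fz fz1
  field_simp
  ring

lemma I1 {y : ℂ} (hR : Rq y ≠ 0) (hS : Sq y ≠ 0) :
    (y ^ 2 + 9) * (y ^ 2 + 384) * (kk (1/24) y * fz1 y + fz2 y + kk (1/24) y * fz1 y)
    + (3/2 * y * (y ^ 2 + 384) + y * (y ^ 2 + 9)) * fz1 y
    = (121500 * (y - 4) ^ 4 * (72 + 7 * y) ^ 2 / (Rq y ^ 2 * Sq y))
      * (5/6 - (1/24 + 13/24 + 1) * fz y) := by
  unfold kk fz fz1 fz2
  field_simp
  simp only [Rq, Sq]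
  ring

lemma I0 {y : ℂ} (hR : Rq y ≠ 0) (hS : Sq y ≠ 0) :
    (y ^ 2 + 9) * (y ^ 2 + 384) * (kk (1/24) y * kk (1/24) y + kk1 (1/24) y)
    + (3/2 * y * (y ^ 2 + 384) + y * (y ^ 2 + 9)) * kk (1/24) y + (5/16 * y ^ 2 + 135/4)
    = -(121500 * (y - 4) ^ 4 * (72 + 7 * y) ^ 2 / (Rq y ^ 2 * Sq y)) * (1/24 * (13/24)) := by
  unfold kk kk1
  field_simp
  simp only [Rq, Sq]
  ring

lemma J1 {y : ℂ} (hR : Rq y ≠ 0) (hS : Sq y ≠ 0) :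
    (y ^ 2 + 9) * (y ^ 2 + 384) * (kk (5/24) y * ((4 - y) * fz1 y) + ((4 - y) * fz2 y - fz1 y)
      + (kk (5/24) y * (4 - y) - 1) * fz1 y)
    + (3/2 * y * (y ^ 2 + 384) + y * (y ^ 2 + 9)) * ((4 - y) * fz1 y)
    = (4 - y) * (121500 * (y - 4) ^ 4 * (72 + 7 * y) ^ 2 / (Rq y ^ 2 * Sq y))
      * (7/6 - (5/24 + 17/24 + 1) * fz y) := by
  unfold kk fz fz1 fz2
  field_simp
  simp only [Rq, Sq]
  ring

lemma J0 {y : ℂ} (hR : Rq y ≠ 0) (hS : Sq y ≠ 0) :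
    (y ^ 2 + 9) * (y ^ 2 + 384) * (kk (5/24) y * (kk (5/24) y * (4 - y) - 1)
      + (kk1 (5/24) y * (4 - y) - kk (5/24) y))
    + (3/2 * y * (y ^ 2 + 384) + y * (y ^ 2 + 9)) * (kk (5/24) y * (4 - y) - 1)
    + (5/16 * y ^ 2 + 135/4) * (4 - y)
    = -(4 - y) * (121500 * (y - 4) ^ 4 * (72 + 7 * y) ^ 2 / (Rq y ^ 2 * Sq y)) * (5/24 * (17/24)) := by
  unfold kk kk1
  field_simp
  simp only [Rq, Sq]
  ring

/-- coefficients of the first series -/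
noncomputable def u1 : ℕ → ℝ := hco (1/24) (13/24) (5/6)
/-- coefficients of the second series -/
noncomputable def u2 : ℕ → ℝ := hco (5/24) (17/24) (7/6)

lemma u1_pos (n : ℕ) : 0 < u1 n := hco_pos (by norm_num) (by norm_num) (by norm_num) n
lemma u2_pos (n : ℕ) : 0 < u2 n := hco_pos (by norm_num) (by norm_num) (by norm_num) n
lemma u1_sum : Summable u1 :=
  hco_summable (κ := 1/40) (by norm_num) (by norm_num) (by norm_num) (by norm_num) (by norm_num)
    (by norm_num)
lemma u2_sum : Summable u2 :=
  hco_summable (κ := 1/40) (by norm_num) (by norm_num) (by norm_num) (by norm_num) (by norm_num)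
    (by norm_num)
lemma u1_gr : PolyGr u1 := polyGr_of_summable u1_sum u1_pos
lemma u2_gr : PolyGr u2 := polyGr_of_summable u2_sum u2_pos

lemma Y_ode {y : ℂ} (hy : Good y) : Lop y (Y0 u1 y) (Y1 u1 y) (Y2 u1 y) = 0 := by
  have hR := Complex.slitPlane_ne_zero hy.1
  have hS := Complex.slitPlane_ne_zero hy.2.1
  have E := serC_ode u1_gr (fun n => hco_succ (by norm_num) n) hy.2.2
  have i0 := I0 hR hS
  have i1 := I1 hR hS
  have i2 := I2 hR hS
  push_cast at E
  unfold Lop Y0 Y1 Y2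
  generalize 121500 * (y - 4) ^ 4 * (72 + 7 * y) ^ 2 / (Rq y ^ 2 * Sq y) = X at *
  linear_combination hh (1/24) y * (X * E + serC u1 (fz y) * i0 + serC (dco u1) (fz y) * i1
    + serC (dco (dco u1)) (fz y) * i2)

lemma Z_ode {y : ℂ} (hy : Good y) : Lop y (Z0 u2 y) (Z1 u2 y) (Z2 u2 y) = 0 := by
  have hR := Complex.slitPlane_ne_zero hy.1
  have hS := Complex.slitPlane_ne_zero hy.2.1
  have E := serC_ode u2_gr (fun n => hco_succ (by norm_num) n) hy.2.2
  have i0 := J0 hR hS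
  have i1 := J1 hR hS
  have i2 := I2 hR hS
  push_cast at E
  unfold Lop Z0 Z1 Z2
  generalize 121500 * (y - 4) ^ 4 * (72 + 7 * y) ^ 2 / (Rq y ^ 2 * Sq y) = X at *
  linear_combination hh (5/24) y * ((4 - y) * X * E + serC u2 (fz y) * i0
    + serC (dco u2) (fz y) * i1 + (4 - y) * serC (dco (dco u2)) (fz y) * i2)

lemma path_zero {g g1 g2 : ℂ → ℂ} {A B : ℂ}
    (hg : ∀ s : ℝ, s ∈ Set.Icc (0 : ℝ) 1 → HasDerivAt g (g1 (A + s * B)) (A + s * B))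
    (hg1 : ∀ s : ℝ, s ∈ Set.Icc (0 : ℝ) 1 → HasDerivAt g1 (g2 (A + s * B)) (A + s * B))
    (hL : ∀ s : ℝ, s ∈ Set.Icc (0 : ℝ) 1 →
      Lop (A + s * B) (g (A + s * B)) (g1 (A + s * B)) (g2 (A + s * B)) = 0)
    (hne : ∀ s : ℝ, s ∈ Set.Icc (0 : ℝ) 1 →
      ((A + s * B) ^ 2 + 9) * ((A + s * B) ^ 2 + 384) ≠ 0)
    (h0 : g A = 0) (h1 : g1 A = 0) : g (A + B) = 0 ∧ g1 (A + B) = 0 := by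
  set γ : ℝ → ℂ := fun s => A + s * B with hγ
  have hγc : Continuous γ := by fun_prop
  have hγd : ∀ s, HasDerivAt γ B s := fun s => by
    have h3 : HasDerivAt γ _ s := (((hasDerivAt_id s).ofReal_comp).mul_const B).const_add A
    convert! h3 using 1
    simp
  set b : ℝ → ℂ := fun s => (3/2 * γ s * (γ s ^ 2 + 384) + γ s * (γ s ^ 2 + 9)) /
    ((γ s ^ 2 + 9) * (γ s ^ 2 + 384)) with hb
  set c : ℝ → ℂ := fun s => (5/16 * γ s ^ 2 + 135/4) /
    ((γ s ^ 2 + 9) * (γ s ^ 2 + 384)) with hc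
  have hbc : ContinuousOn b (Set.Icc 0 1) :=
    ContinuousOn.div (by fun_prop) (by fun_prop) hne
  have hcc : ContinuousOn c (Set.Icc 0 1) :=
    ContinuousOn.div (by fun_prop) (by fun_prop) hne
  obtain ⟨M1, hM1⟩ := isCompact_Icc.exists_bound_of_continuousOn hbc
  obtain ⟨M2, hM2⟩ := isCompact_Icc.exists_bound_of_continuousOn hcc
  have hM1' : 0 ≤ M1 := (norm_nonneg _).trans (hM1 0 (by simp))
  have hM2' : 0 ≤ M2 := (norm_nonneg _).trans (hM2 0 (by simp))
  have hd : ∀ s ∈ Set.Icc (0 : ℝ) 1, HasDerivAt (fun s => (g (γ s), g1 (γ s)))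
      (g1 (γ s) * B, g2 (γ s) * B) s := fun s hs =>
    ((hg s hs).comp s (hγd s)).prodMk ((hg1 s hs).comp s (hγd s))
  have key := eq_zero_of_abs_deriv_le_mul_abs_self_of_eq_zero_right
    (f := fun s => (g (γ s), g1 (γ s))) (f' := fun s => (g1 (γ s) * B, g2 (γ s) * B))
    (K := (1 + M1 + M2) * ‖B‖) (a := 0) (b := 1)
    (fun s hs => (hd s hs).continuousAt.continuousWithinAt)
    (fun s hs => (hd s ⟨hs.1, hs.2.le⟩).hasDerivWithinAt)
    (by simp [hγ, h0, h1]) ?_ 1 (by simp)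
  · simp only [hγ, Complex.ofReal_one, one_mul, Prod.mk_eq_zero] at key
    exact key
  · intro s hs
    have hs' : s ∈ Set.Icc (0 : ℝ) 1 := ⟨hs.1, hs.2.le⟩
    have e2 : g2 (γ s) = -(b s * g1 (γ s) + c s * g (γ s)) := by
      have h := hL s hs'
      have hn := hne s hs'
      simp only [hb, hc]
      change Lop (γ s) (g (γ s)) (g1 (γ s)) (g2 (γ s)) = 0 at h
      change (γ s ^ 2 + 9) * (γ s ^ 2 + 384) ≠ 0 at hn
      have hn1 := left_ne_zero_of_mul hn
      have hn2 := right_ne_zero_of_mul hn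
      unfold Lop at h
      generalize γ s = y at *
      generalize hx : y ^ 2 + 9 = x at *
      generalize hz : y ^ 2 + 384 = z at *
      field_simp
      linear_combination 128 * h
    have n1 : ‖g1 (γ s)‖ ≤ ‖(g (γ s), g1 (γ s))‖ := norm_snd_le (g (γ s), g1 (γ s))
    have n0 : ‖g (γ s)‖ ≤ ‖(g (γ s), g1 (γ s))‖ := norm_fst_le (g (γ s), g1 (γ s))
    have nn : 0 ≤ ‖(g (γ s), g1 (γ s))‖ := norm_nonneg _
    have m1 := hM1 s hs'
    have m2 := hM2 s hs'
    set N := ‖(g (γ s), g1 (γ s))‖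
    have hB := norm_nonneg B
    have q2 : ‖g2 (γ s)‖ ≤ (M1 + M2) * N := by
      rw [e2, norm_neg]
      calc ‖b s * g1 (γ s) + c s * g (γ s)‖ ≤ ‖b s‖ * ‖g1 (γ s)‖ + ‖c s‖ * ‖g (γ s)‖ := by
            refine (norm_add_le _ _).trans ?_
            rw [norm_mul, norm_mul]
        _ ≤ M1 * N + M2 * N := by gcongr
        _ = _ := by ring
    rw [Prod.norm_def]
    refine max_le ?_ ?_
    · rw [norm_mul]
      calc ‖g1 (γ s)‖ * ‖B‖ ≤ N * ‖B‖ := by gcongr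
        _ ≤ _ := by nlinarith [mul_nonneg nn hB, mul_nonneg (mul_nonneg nn hB) hM1', mul_nonneg (mul_nonneg nn hB) hM2']
    · rw [norm_mul]
      calc ‖g2 (γ s)‖ * ‖B‖ ≤ (M1 + M2) * N * ‖B‖ := by gcongr
        _ ≤ _ := by nlinarith [mul_nonneg nn hB]

lemma Lop_neg (y a b c : ℂ) : Lop y a (-b) c = Lop (-y) a b c := by
  unfold Lop; ring

lemma good_real {x : ℝ} (h1 : -4 ≤ x) (h2 : x ≤ 4) : Good (x : ℂ) := by
  have hR : Rq (x : ℂ) = ((76 * x ^ 2 + 117 * x + 816 : ℝ) : ℂ) := by simp [Rq]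
  have hS : Sq (x : ℂ) = ((x ^ 2 + 384 : ℝ) : ℂ) := by simp [Sq]
  have pR : 0 < 76 * x ^ 2 + 117 * x + 816 := by nlinarith [sq_nonneg (x + 1)]
  have pS : 0 < x ^ 2 + 384 := by positivity
  have hf : fz (x : ℂ) = ((3375 * (x - 4) ^ 6 / ((76 * x ^ 2 + 117 * x + 816) ^ 2 * (x ^ 2 + 384)) : ℝ) : ℂ) := by
    simp [fz, Rq, Sq]
  refine ⟨?_, ?_, ?_⟩
  · rw [hR]; exact Complex.ofReal_mem_slitPlane.2 pR
  · rw [hS]; exact Complex.ofReal_mem_slitPlane.2 pS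
  · rw [hf, Complex.norm_real, Real.norm_of_nonneg (by positivity), div_lt_one (by positivity)]
    have : 0 < (x ^ 2 + 9) * (72 + 7 * x) ^ 4 := by
      have : 0 < 72 + 7 * x := by linarith
      positivity
    nlinarith [this]

lemma fz_imag {η : ℝ} (h : η ^ 2 ≤ 9) : ‖fz (η * Complex.I)‖ ≤ 1 ∧ (η ^ 2 < 9 → ‖fz (η * Complex.I)‖ < 1) := by
  have hR : ‖Rq (η * Complex.I)‖ ^ 2 = (816 - 76 * η ^ 2) ^ 2 + (117 * η) ^ 2 := by
    rw [← Complex.normSq_eq_norm_sq, Complex.normSq_apply]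
    have : Rq (η * Complex.I) = ((816 - 76 * η ^ 2 : ℝ) : ℂ) + ((117 * η : ℝ) : ℂ) * Complex.I := by
      simp [Rq, mul_pow]; ring
    rw [this]; simp [-Complex.ofReal_sub, -Complex.ofReal_mul]; ring
  have hS : ‖Sq (η * Complex.I)‖ = 384 - η ^ 2 := by
    have : Sq (η * Complex.I) = ((384 - η ^ 2 : ℝ) : ℂ) := by
      simp [Sq, mul_pow]; ring
    rw [this, Complex.norm_real, Real.norm_of_nonneg (by linarith)]
  have hy : ‖(η * Complex.I - 4 : ℂ)‖ ^ 2 = η ^ 2 + 16 := by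
    rw [← Complex.normSq_eq_norm_sq, Complex.normSq_apply]
    simp; ring
  have hf : ‖fz (η * Complex.I)‖ = 3375 * (η ^ 2 + 16) ^ 3 /
      (((816 - 76 * η ^ 2) ^ 2 + (117 * η) ^ 2) * (384 - η ^ 2)) := by
    unfold fz
    rw [norm_div, norm_mul, norm_mul, norm_pow, norm_pow, hR, hS, ← hy]
    norm_num
    ring
  have pR : 0 < (816 - 76 * η ^ 2) ^ 2 + (117 * η) ^ 2 := by
    have : 0 < 816 - 76 * η ^ 2 := by linarith
    positivity
  have pS : 0 < 384 - η ^ 2 := by linarith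
  have key : (((816 - 76 * η ^ 2) ^ 2 + (117 * η) ^ 2) * (384 - η ^ 2)) - 3375 * (η ^ 2 + 16) ^ 3
      = (9 - η ^ 2) * (9151 * (η ^ 2) ^ 2 - 2083968 * η ^ 2 + 26873856) := by ring
  have p2 : 0 < 9151 * (η ^ 2) ^ 2 - 2083968 * η ^ 2 + 26873856 := by nlinarith [sq_nonneg (η ^ 2)]
  rw [hf, div_le_one (by positivity), div_lt_one (by positivity)]
  constructor
  · nlinarith [mul_nonneg (sub_nonneg.2 h) p2.le]
  · intro h'
    nlinarith [mul_pos (sub_pos.2 h') p2]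

lemma slit_imag {η : ℝ} (h : η ^ 2 ≤ 9) : Rq (η * Complex.I) ∈ Complex.slitPlane ∧
    Sq (η * Complex.I) ∈ Complex.slitPlane := by
  constructor
  · left
    have : (Rq (η * Complex.I)).re = 816 - 76 * η ^ 2 := by
      have : Rq (η * Complex.I) = ((816 - 76 * η ^ 2 : ℝ) : ℂ) + ((117 * η : ℝ) : ℂ) * Complex.I := by
        simp [Rq, mul_pow]; ring
      rw [this]; simp [-Complex.ofReal_sub, -Complex.ofReal_mul]
    rw [this]; linarith
  · have : Sq (η * Complex.I) = ((384 - η ^ 2 : ℝ) : ℂ) := by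
      simp [Sq, mul_pow]; ring
    rw [this]; exact Complex.ofReal_mem_slitPlane.2 (by linarith)

lemma good_imag {η : ℝ} (h : η ^ 2 < 9) : Good (η * Complex.I) :=
  ⟨(slit_imag h.le).1, (slit_imag h.le).2, (fz_imag h.le).2 h⟩

/-- difference function -/
noncomputable def gg (p q : ℂ) (y : ℂ) : ℂ := Y0 u1 (-y) - p * Y0 u1 y - q * Z0 u2 y
/-- derivative -/
noncomputable def gg1 (p q : ℂ) (y : ℂ) : ℂ := -Y1 u1 (-y) - p * Y1 u1 y - q * Z1 u2 y
/-- second derivative -/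
noncomputable def gg2 (p q : ℂ) (y : ℂ) : ℂ := Y2 u1 (-y) - p * Y2 u1 y - q * Z2 u2 y

lemma gg_deriv (p q : ℂ) {y : ℂ} (h1 : Good y) (h2 : Good (-y)) :
    HasDerivAt (gg p q) (gg1 p q y) y := by
  have a : HasDerivAt (fun y => Y0 u1 (-y)) (-Y1 u1 (-y)) y := by
    have h3 : HasDerivAt (fun y => Y0 u1 (-y)) _ y := (Y0_deriv u1_gr h2).comp y (hasDerivAt_neg y)
    convert! h3 using 1
    ring
  exact (a.sub ((Y0_deriv u1_gr h1).const_mul p)).sub ((Z0_deriv u2_gr h1).const_mul q)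

lemma gg1_deriv (p q : ℂ) {y : ℂ} (h1 : Good y) (h2 : Good (-y)) :
    HasDerivAt (gg1 p q) (gg2 p q y) y := by
  have a : HasDerivAt (fun y => -Y1 u1 (-y)) (Y2 u1 (-y)) y := by
    have h3 : HasDerivAt (fun y => -Y1 u1 (-y)) _ y :=
      ((Y1_deriv u1_gr h2).comp y (hasDerivAt_neg y)).neg
    convert! h3 using 1
    ring
  exact (a.sub ((Y1_deriv u1_gr h1).const_mul p)).sub ((Z1_deriv u2_gr h1).const_mul q)

lemma gg_ode (p q : ℂ) {y : ℂ} (h1 : Good y) (h2 : Good (-y)) :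
    Lop y (gg p q y) (gg1 p q y) (gg2 p q y) = 0 := by
  have a := Y_ode h2
  rw [← Lop_neg] at a
  have b := Y_ode h1
  have c := Z_ode h1
  unfold Lop at *
  unfold gg gg1 gg2
  linear_combination a - p * b - q * c

lemma gg_imag {p q : ℂ} (h0 : gg p q 4 = 0) (h1 : gg1 p q 4 = 0) {η : ℝ} (hη : η ∈ Set.Ico (0 : ℝ) 3) :
    gg p q (η * Complex.I) = 0 := by
  have G1 : ∀ s : ℝ, s ∈ Set.Icc (0 : ℝ) 1 → Good ((4 : ℂ) + s * (-4)) ∧ Good (-((4 : ℂ) + s * (-4))) := by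
    intro s hs
    have a := good_real (x := 4 + s * (-4)) (by linarith [hs.2]) (by linarith [hs.1])
    have b := good_real (x := -(4 + s * (-4))) (by linarith [hs.1]) (by linarith [hs.2])
    push_cast at a b
    exact ⟨a, b⟩
  have st1 := path_zero (g := gg p q) (g1 := gg1 p q) (g2 := gg2 p q) (A := 4) (B := -4)
    (fun s hs => gg_deriv p q (G1 s hs).1 (G1 s hs).2)
    (fun s hs => gg1_deriv p q (G1 s hs).1 (G1 s hs).2)
    (fun s hs => gg_ode p q (G1 s hs).1 (G1 s hs).2)
    (fun s hs => by
      have : (((4 : ℂ) + s * (-4)) ^ 2 + 9) * (((4 : ℂ) + s * (-4)) ^ 2 + 384)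
        = (((4 + s * (-4)) ^ 2 + 9) * ((4 + s * (-4)) ^ 2 + 384) : ℝ) := by push_cast; ring
      rw [this]
      exact Complex.ofReal_ne_zero.2 (by positivity)) h0 h1
  have z0 : (4 : ℂ) + -4 = 0 := by ring
  rw [z0] at st1
  have sq : ∀ s : ℝ, s ∈ Set.Icc (0 : ℝ) 1 → (s * η) ^ 2 < 9 := by
    intro s hs
    have : s * η ≤ η := mul_le_of_le_one_left hη.1 hs.2
    have h3 : 0 ≤ s * η := mul_nonneg hs.1 hη.1
    nlinarith [hη.2]
  have G2 : ∀ s : ℝ, s ∈ Set.Icc (0 : ℝ) 1 → Good ((0 : ℂ) + s * (η * Complex.I)) ∧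
      Good (-((0 : ℂ) + s * (η * Complex.I))) := by
    intro s hs
    have a := good_imag (sq s hs)
    have b := good_imag (η := -(s * η)) (by rw [neg_sq]; exact sq s hs)
    push_cast at a b
    constructor
    · convert a using 1; ring
    · convert b using 1; ring
  have st2 := path_zero (g := gg p q) (g1 := gg1 p q) (g2 := gg2 p q) (A := 0) (B := η * Complex.I)
    (fun s hs => gg_deriv p q (G2 s hs).1 (G2 s hs).2)
    (fun s hs => gg1_deriv p q (G2 s hs).1 (G2 s hs).2)
    (fun s hs => gg_ode p q (G2 s hs).1 (G2 s hs).2)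
    (fun s hs => by
      have : (((0 : ℂ) + s * (η * Complex.I)) ^ 2 + 9) * (((0 : ℂ) + s * (η * Complex.I)) ^ 2 + 384)
        = ((9 - (s * η) ^ 2) * (384 - (s * η) ^ 2) : ℝ) := by
          simp [mul_pow]; ring
      rw [this]
      have := sq s hs
      exact Complex.ofReal_ne_zero.2 (mul_pos (by linarith) (by linarith)).ne') st1.1 st1.2
  simpa using st2.1

lemma hh_cont (e : ℂ) (σ : ℝ) (hσ : σ ^ 2 = 1) :
    ContinuousOn (fun η : ℝ => hh e ((σ * η : ℝ) * Complex.I)) (Set.Icc 0 3) := by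
  intro η hη
  have hs : (σ * η) ^ 2 ≤ 9 := by rw [mul_pow, hσ]; nlinarith [hη.1, hη.2]
  have h := (hh_deriv e (slit_imag hs).1 (slit_imag hs).2).continuousAt
  have c : ContinuousAt (fun η : ℝ => ((σ * η : ℝ) : ℂ) * Complex.I) η := by fun_prop
  exact (ContinuousAt.comp (f := fun η : ℝ => ((σ * η : ℝ) : ℂ) * Complex.I) h c).continuousWithinAt

lemma ser_cont {u : ℕ → ℝ} (h : Summable u) (hp : ∀ n, 0 < u n) (σ : ℝ) (hσ : σ ^ 2 = 1) :
    ContinuousOn (fun η : ℝ => serC u (fz ((σ * η : ℝ) * Complex.I))) (Set.Icc 0 3) := by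
  have hs : ∀ η ∈ Set.Icc (0 : ℝ) 3, (σ * η) ^ 2 ≤ 9 := fun η hη => by
    rw [mul_pow, hσ]; nlinarith [hη.1, hη.2]
  refine (serC_continuousOn h hp).comp (f := fun η : ℝ => fz ((σ * η : ℝ) * Complex.I)) ?_ ?_
  · intro η hη
    have s := slit_imag (hs η hη)
    have h := (fz_deriv (Complex.slitPlane_ne_zero s.1) (Complex.slitPlane_ne_zero s.2)).continuousAt
    have c : ContinuousAt (fun η : ℝ => ((σ * η : ℝ) : ℂ) * Complex.I) η := by fun_prop
    exact (ContinuousAt.comp (f := fun η : ℝ => ((σ * η : ℝ) : ℂ) * Complex.I) h c).continuousWithinAt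
  · intro η hη
    simpa using (fz_imag (hs η hη)).1

lemma gg_lim {p q : ℂ} (h0 : gg p q 4 = 0) (h1 : gg1 p q 4 = 0) :
    hh (1/24) (-(3 * Complex.I)) * serC u1 (fz (-(3 * Complex.I)))
      - p * (hh (1/24) (3 * Complex.I) * serC u1 (fz (3 * Complex.I)))
      - q * (hh (5/24) (3 * Complex.I) * ((4 - 3 * Complex.I) * serC u2 (fz (3 * Complex.I)))) = 0 := by
  have hc : ContinuousOn (fun η : ℝ =>
      hh (1/24) (((-1) * η : ℝ) * Complex.I) * serC u1 (fz (((-1) * η : ℝ) * Complex.I))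
      - p * (hh (1/24) ((1 * η : ℝ) * Complex.I) * serC u1 (fz ((1 * η : ℝ) * Complex.I)))
      - q * (hh (5/24) ((1 * η : ℝ) * Complex.I) * ((4 - η * Complex.I) * serC u2 (fz ((1 * η : ℝ) * Complex.I)))))
      (Set.Icc 0 3) := by
    have a1 := hh_cont (1/24) (-1) (by norm_num)
    have a2 := ser_cont u1_sum u1_pos (-1) (by norm_num)
    have a3 := hh_cont (1/24) 1 (by norm_num)
    have a4 := ser_cont u1_sum u1_pos 1 (by norm_num)
    have a5 := hh_cont (5/24) 1 (by norm_num)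
    have a6 := ser_cont u2_sum u2_pos 1 (by norm_num)
    have a7 : ContinuousOn (fun η : ℝ => (4 - η * Complex.I : ℂ)) (Set.Icc 0 3) := by fun_prop
    exact ((a1.mul a2).sub (continuousOn_const.mul (a3.mul a4))).sub
      (continuousOn_const.mul (a5.mul (a7.mul a6)))
  have he : Set.EqOn (fun η : ℝ =>
      hh (1/24) (((-1) * η : ℝ) * Complex.I) * serC u1 (fz (((-1) * η : ℝ) * Complex.I))
      - p * (hh (1/24) ((1 * η : ℝ) * Complex.I) * serC u1 (fz ((1 * η : ℝ) * Complex.I)))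
      - q * (hh (5/24) ((1 * η : ℝ) * Complex.I) * ((4 - η * Complex.I) * serC u2 (fz ((1 * η : ℝ) * Complex.I)))))
      (fun _ => 0) (Set.Ico 0 3) := by
    intro η hη
    have := gg_imag h0 h1 hη
    unfold gg Y0 Z0 at this
    simpa using this
  have := he.of_subset_closure hc continuousOn_const Set.Ico_subset_Icc_self
    (by rw [closure_Ico (by norm_num)]) (show (3 : ℝ) ∈ Set.Icc (0 : ℝ) 3 by norm_num)
  simpa using this

lemma hh_real (e x : ℝ) : hh (e : ℂ) (x : ℂ) =
    (((76 * x ^ 2 + 117 * x + 816) ^ (-2 * e) * (x ^ 2 + 384) ^ (-e) : ℝ) : ℂ) := by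
  have pR : 0 < 76 * x ^ 2 + 117 * x + 816 := by nlinarith [sq_nonneg (x + 1)]
  have pS : 0 < x ^ 2 + 384 := by positivity
  rw [Complex.ofReal_mul, Complex.ofReal_cpow pR.le, Complex.ofReal_cpow pS.le]
  simp [hh, Rq, Sq]

lemma fz_real (x : ℝ) : ∃ r : ℝ, fz (x : ℂ) = r :=
  ⟨3375 * (x - 4) ^ 6 / ((76 * x ^ 2 + 117 * x + 816) ^ 2 * (x ^ 2 + 384)), by
    simp [fz, Rq, Sq]⟩

lemma fz1_real (x : ℝ) : ∃ r : ℝ, fz1 (x : ℂ) = r :=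
  ⟨20250 * (x - 4) ^ 5 * (72 + 7 * x) ^ 3 /
    ((76 * x ^ 2 + 117 * x + 816) ^ 3 * (x ^ 2 + 384) ^ 2), by
    simp [fz1, Rq, Sq]⟩

lemma kk_real (e x : ℝ) : ∃ r : ℝ, kk (e : ℂ) (x : ℂ) = r :=
  ⟨-2 * e * (152 * x + 117) / (76 * x ^ 2 + 117 * x + 816) - e * (2 * x) / (x ^ 2 + 384), by
    simp [kk, Rq, Sq]⟩

lemma c24 : (1/24 : ℂ) = ((1/24 : ℝ) : ℂ) := by norm_num
lemma c524 : (5/24 : ℂ) = ((5/24 : ℝ) : ℂ) := by norm_num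

lemma Y1_real (x : ℝ) : ∃ r : ℝ, Y1 u1 (x : ℂ) = r := by
  obtain ⟨a, ha⟩ := fz_real x
  obtain ⟨b, hb⟩ := fz1_real x
  obtain ⟨c, hc⟩ := kk_real (1/24) x
  unfold Y1
  rw [c24, hh_real, ha, hb, hc, serC_real, serC_real]
  exact ⟨_, by rw [← Complex.ofReal_mul, ← Complex.ofReal_mul, ← Complex.ofReal_add,
    ← Complex.ofReal_mul]⟩

lemma serC_zero (u : ℕ → ℝ) : serC u 0 = u 0 := by
  unfold serC
  rw [tsum_eq_single 0 (fun n hn => by simp [hn])]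
  simp

lemma fz4 : fz 4 = 0 := by simp [fz]
lemma fz14 : fz1 4 = 0 := by simp [fz1]

lemma Y0_4 : Y0 u1 4 = (((2500:ℝ) ^ (-2 * (1/24 : ℝ)) * 400 ^ (-(1/24) : ℝ) : ℝ) : ℂ) := by
  unfold Y0
  have := hh_real (1/24) 4
  rw [fz4, serC_zero, u1, hco_zero, c24]
  rw [show ((4:ℝ):ℂ) = 4 by norm_num] at this
  rw [this]
  norm_num

lemma Y0_n4 : Y0 u1 (-4) = (((1564:ℝ) ^ (-2 * (1/24 : ℝ)) * 400 ^ (-(1/24) : ℝ) *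
    twoFone (1/24) (13/24) (5/6) (138240/152881) : ℝ) : ℂ) := by
  unfold Y0
  have := hh_real (1/24) (-4)
  have hf : fz (-4) = ((138240/152881 : ℝ) : ℂ) := by
    norm_num [fz, Rq, Sq]
  rw [show ((-4:ℝ):ℂ) = -4 by norm_num] at this
  rw [hf, serC_real, c24, this]
  rw [show (∑' n, u1 n * (138240/152881 : ℝ) ^ n) = twoFone (1/24) (13/24) (5/6) (138240/152881) from rfl]
  norm_num

lemma Z0_4 : Z0 u2 4 = 0 := by
  unfold Z0; simp

lemma Z1_4 : ∃ r : ℝ, r ≠ 0 ∧ Z1 u2 4 = r := by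
  have := hh_real (5/24) 4
  rw [show ((4:ℝ):ℂ) = 4 by norm_num] at this
  refine ⟨-((76 * 4 ^ 2 + 117 * 4 + 816 : ℝ) ^ (-2 * (5/24) : ℝ) * (4 ^ 2 + 384 : ℝ) ^ (-(5/24) : ℝ)), ?_, ?_⟩
  · have h1 := Real.rpow_pos_of_pos (show (0:ℝ) < 76 * 4 ^ 2 + 117 * 4 + 816 by norm_num) (-2 * (5/24) : ℝ)
    have h2 := Real.rpow_pos_of_pos (show (0:ℝ) < 4 ^ 2 + 384 by norm_num) (-(5/24) : ℝ)
    exact neg_ne_zero.2 (mul_pos h1 h2).ne'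
  · unfold Z1
    rw [fz4, fz14, serC_zero, u2, hco_zero, c524, this, Complex.ofReal_neg]
    simp

lemma exists_pq : ∃ p q : ℝ, (1564:ℝ) ^ (-2 * (1/24 : ℝ)) *
    twoFone (1/24) (13/24) (5/6) (138240/152881) = p * (2500:ℝ) ^ (-2 * (1/24 : ℝ)) ∧
    gg p q 4 = 0 ∧ gg1 p q 4 = 0 := by
  obtain ⟨z, hz, hZ⟩ := Z1_4
  obtain ⟨a, ha⟩ := Y1_real 4
  obtain ⟨b, hb⟩ := Y1_real (-4)
  rw [show ((4:ℝ):ℂ) = 4 by norm_num] at ha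
  rw [show ((-4:ℝ):ℂ) = -4 by norm_num] at hb
  have h25 := Real.rpow_pos_of_pos (show (0:ℝ) < 2500 by norm_num) (-2 * (1/24) : ℝ)
  set t := (2500:ℝ) ^ (-2 * (1/24 : ℝ)) with ht
  set w := twoFone (1/24) (13/24) (5/6) (138240/152881) with hw
  set s := (1564:ℝ) ^ (-2 * (1/24 : ℝ)) with hs
  have hp : s * w = (s * w / t) * t := by field_simp
  set p := s * w / t with hpp
  refine ⟨p, (-b - p * a) / z, hp, ?_, ?_⟩
  · unfold gg
    rw [Y0_4, Y0_n4, Z0_4, ← ht, ← hw, ← hs, mul_zero, sub_zero, ← Complex.ofReal_mul,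
      ← Complex.ofReal_sub]
    rw [Complex.ofReal_eq_zero]
    linear_combination (400:ℝ) ^ (-(1/24) : ℝ) * hp
  · unfold gg1
    rw [ha, hb, hZ, ← Complex.ofReal_mul, ← Complex.ofReal_mul, ← Complex.ofReal_neg,
      ← Complex.ofReal_sub, ← Complex.ofReal_sub, Complex.ofReal_eq_zero]
    field_simp
    ring

/-- the angle -/
noncomputable def bet : ℝ := Real.arctan (1/3)

lemma bet_cos : Real.cos bet ^ 2 = 9/10 := by
  unfold bet
  rw [Real.cos_sq_arctan]; norm_num

lemma bet_cos_pos : 0 < Real.cos bet := Real.cos_arctan_pos _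

lemma bet_pos : 0 < bet := by
  unfold bet
  exact Real.arctan_pos.2 (by norm_num)

lemma bet_lt : bet < Real.pi / 4 := by
  unfold bet
  rw [← Real.arctan_one]
  exact Real.arctan_strictMono (by norm_num)

lemma bet_sin : Real.sin bet = Real.cos bet / 3 := by
  have h : Real.tan bet = 1/3 := Real.tan_arctan _
  rw [Real.tan_eq_sin_div_cos, div_eq_iff bet_cos_pos.ne'] at h
  linarith

lemma exp_bet2 : Complex.exp (-(2 * bet) * Complex.I) = (4 - 3 * Complex.I) / 5 := by
  have : (-(2 * bet) * Complex.I : ℂ) = ((-(2 * bet) : ℝ) : ℂ) * Complex.I := by push_cast; ring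
  rw [this, Complex.exp_mul_I, ← Complex.ofReal_cos, ← Complex.ofReal_sin, Real.cos_neg, Real.sin_neg,
    Real.cos_two_mul, Real.sin_two_mul, bet_sin]
  have e1 : 2 * Real.cos bet ^ 2 - 1 = 4/5 := by rw [bet_cos]; norm_num
  have e2 : -(2 * (Real.cos bet / 3) * Real.cos bet) = -3/5 := by linear_combination (-2/3) * bet_cos
  rw [e1, e2]
  push_cast
  ring

lemma exp_th : Complex.exp (((Real.pi - 6 * bet : ℝ) : ℂ) * Complex.I) = (132 + 351 * Complex.I) / 375 := by
  have : (((Real.pi - 6 * bet : ℝ) : ℂ) * Complex.I : ℂ) =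
    Real.pi * Complex.I + (3 : ℕ) * (-(2 * bet) * Complex.I) := by push_cast; ring
  rw [this, Complex.exp_add, Complex.exp_pi_mul_I, Complex.exp_nat_mul, exp_bet2]
  have : Complex.I ^ 3 = -Complex.I := Complex.I_pow_three
  linear_combination (-108/125 + 27/125 * Complex.I) * Complex.I_sq

lemma exp_thn : Complex.exp (((-(Real.pi - 6 * bet) : ℝ) : ℂ) * Complex.I) = (132 - 351 * Complex.I) / 375 := by
  have := exp_th
  rw [show (((-(Real.pi - 6 * bet) : ℝ) : ℂ) * Complex.I) = -(((Real.pi - 6 * bet : ℝ) : ℂ) * Complex.I) by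
    push_cast; ring, Complex.exp_neg, this]
  have hne : (132 + 351 * Complex.I : ℂ) ≠ 0 := by
    intro h
    have := congrArg Complex.re h
    norm_num at this
  field_simp
  linear_combination 123201 * Complex.I_sq

lemma hh_polar (e θ : ℝ) (y : ℂ) (h1 : -Real.pi < θ) (h2 : θ ≤ Real.pi)
    (hR : Rq y = (375 : ℝ) * Complex.exp ((θ : ℂ) * Complex.I)) (hS : Sq y = (375 : ℝ)) :
    hh (e : ℂ) y = ((375 ^ (-2 * e) * 375 ^ (-e) : ℝ) : ℂ) * Complex.exp (((-2 * e * θ : ℝ) : ℂ) * Complex.I) := by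
  have h375 : (0:ℝ) < 375 := by norm_num
  have hl : Complex.log (Rq y) = Real.log 375 + θ * Complex.I := by
    rw [hR, Complex.log_ofReal_mul h375 (Complex.exp_ne_zero _), Complex.log_exp]
    · simpa using h1
    · simpa using h2
  have hne : Rq y ≠ 0 := by
    rw [hR]; exact mul_ne_zero (by norm_num) (Complex.exp_ne_zero _)
  have a : Rq y ^ (-2 * e : ℂ) = ((375 ^ (-2 * e) : ℝ) : ℂ) * Complex.exp (((-2 * e * θ : ℝ) : ℂ) * Complex.I) := by
    rw [Complex.cpow_def_of_ne_zero hne, hl, Real.rpow_def_of_pos h375, Complex.ofReal_exp, ← Complex.exp_add]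
    congr 1
    push_cast; ring
  have b : Sq y ^ (-e : ℂ) = ((375 ^ (-e) : ℝ) : ℂ) := by
    rw [hS, Complex.ofReal_cpow h375.le]
    push_cast; rfl
  unfold hh
  rw [a, b]
  push_cast; ring

lemma p_eq {p q : ℝ} (h0 : gg p q 4 = 0) (h1 : gg1 p q 4 = 0) :
    Real.cos bet = p * (Real.sqrt 3 / 2) := by
  have h := gg_lim h0 h1
  have R1 : Rq (3 * Complex.I) = 132 + 351 * Complex.I := by
    unfold Rq; linear_combination 684 * Complex.I_sq
  have R2 : Rq (-(3 * Complex.I)) = 132 - 351 * Complex.I := by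
    unfold Rq; linear_combination 684 * Complex.I_sq
  have S1 : Sq (3 * Complex.I) = (375 : ℝ) := by
    unfold Sq; push_cast; linear_combination 9 * Complex.I_sq
  have S2 : Sq (-(3 * Complex.I)) = (375 : ℝ) := by
    unfold Sq; push_cast; linear_combination 9 * Complex.I_sq
  have n1 : (132 + 351 * Complex.I : ℂ) ≠ 0 := by
    intro h
    have := congrArg Complex.re h
    norm_num at this
  have n2 : (132 - 351 * Complex.I : ℂ) ≠ 0 := by
    intro h
    have := congrArg Complex.re h
    norm_num at this
  have i3 : Complex.I ^ 3 = -Complex.I := Complex.I_pow_three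
  have i4 : Complex.I ^ 4 = 1 := Complex.I_pow_four
  have i5 : Complex.I ^ 5 = Complex.I := by rw [pow_succ, i4, one_mul]
  have i6 : Complex.I ^ 6 = -1 := by rw [pow_succ, i5, Complex.I_mul_I]
  have f1 : fz (3 * Complex.I) = ((1 : ℝ) : ℂ) := by
    unfold fz
    rw [R1, S1, div_eq_iff (mul_ne_zero (pow_ne_zero 2 n1) (by norm_num))]
    push_cast
    ring_nf
    simp only [i3, i4, i5, i6, Complex.I_sq]
    ring
  have f2 : fz (-(3 * Complex.I)) = ((1 : ℝ) : ℂ) := by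
    unfold fz
    rw [R2, S2, div_eq_iff (mul_ne_zero (pow_ne_zero 2 n2) (by norm_num))]
    push_cast
    ring_nf
    simp only [i3, i4, i5, i6, Complex.I_sq]
    ring
  set θ : ℝ := Real.pi - 6 * bet with hθ
  have b1 := bet_pos
  have b2 := bet_lt
  have hpi := Real.pi_pos
  have E1 : Rq (3 * Complex.I) = (375 : ℝ) * Complex.exp ((θ : ℂ) * Complex.I) := by
    rw [R1, exp_th]; push_cast; ring
  have E2 : Rq (-(3 * Complex.I)) = (375 : ℝ) * Complex.exp (((-θ : ℝ) : ℂ) * Complex.I) := by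
    rw [R2, exp_thn]; push_cast; ring
  have e4 : (4 - 3 * Complex.I : ℂ) = 5 * Complex.exp (-(2 * bet) * Complex.I) := by
    rw [exp_bet2]; ring
  rw [c24, c524, hh_polar (1/24) θ _ (by linarith) (by linarith) E1 S1,
    hh_polar (1/24) (-θ) _ (by linarith) (by linarith) E2 S2,
    hh_polar (5/24) θ _ (by linarith) (by linarith) E1 S1, f1, f2, serC_real, serC_real, e4] at h
  simp only [one_pow, mul_one] at h
  have hA : 0 < ∑' n, u1 n := u1_sum.tsum_pos (fun n => (u1_pos n).le) 0 (u1_pos 0)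
  have hc1 : (0:ℝ) < 375 ^ (-2 * (1/24) : ℝ) * 375 ^ (-(1/24) : ℝ) := by positivity
  set A := ∑' n, u1 n
  set B := ∑' n, u2 n
  set c1 : ℝ := 375 ^ (-2 * (1/24) : ℝ) * 375 ^ (-(1/24) : ℝ)
  set c2 : ℝ := 375 ^ (-2 * (5/24) : ℝ) * 375 ^ (-(5/24) : ℝ)
  set X := Complex.exp (((θ / 12 + Real.pi / 3 : ℝ) : ℂ) * Complex.I) with hX
  have x1 : Complex.exp (((-2 * (1/24) * -θ : ℝ) : ℂ) * Complex.I) * X =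
      Complex.exp (((Real.pi / 2 - bet : ℝ) : ℂ) * Complex.I) := by
    rw [hX, ← Complex.exp_add]; congr 1; rw [hθ]; push_cast; ring
  have x2 : Complex.exp (((-2 * (1/24) * θ : ℝ) : ℂ) * Complex.I) * X =
      Complex.exp (((Real.pi / 3 : ℝ) : ℂ) * Complex.I) := by
    rw [hX, ← Complex.exp_add]; congr 1; rw [hθ]; push_cast; ring
  have x3 : Complex.exp (((-2 * (5/24) * θ : ℝ) : ℂ) * Complex.I) * Complex.exp (-(2 * bet) * Complex.I) * X = 1 := by
    rw [hX, ← Complex.exp_add, ← Complex.exp_add, ← Complex.exp_zero]; congr 1; rw [hθ]; push_cast; ring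
  have h' : ((c1 * A : ℝ) : ℂ) * Complex.exp (((Real.pi / 2 - bet : ℝ) : ℂ) * Complex.I)
      = ((p * (c1 * A) : ℝ) : ℂ) * Complex.exp (((Real.pi / 3 : ℝ) : ℂ) * Complex.I)
        + ((q * c2 * 5 * B : ℝ) : ℂ) := by
    rw [← x1, ← x2]
    push_cast at h x3 ⊢
    linear_combination X * h + (q * c2 * 5 * B : ℂ) * x3
  have h2 := congrArg Complex.im h'
  rw [Complex.add_im, Complex.im_ofReal_mul, Complex.im_ofReal_mul, Complex.exp_ofReal_mul_I_im,
    Complex.exp_ofReal_mul_I_im, Complex.ofReal_im, Real.sin_pi_div_two_sub, Real.sin_pi_div_three] at h2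
  have hpos : c1 * A ≠ 0 := (mul_pos hc1 hA).ne'
  apply mul_left_cancel₀ hpos
  linear_combination h2

lemma rp {a : ℝ} (ha : 0 < a) (r : ℝ) (n : ℕ) (m : ℝ) (h : r * n = m) : (a ^ r) ^ n = a ^ m := by
  rw [← Real.rpow_natCast, ← Real.rpow_mul ha.le, h]

theorem stmt8 : twoFone (1/24) (13/24) (5/6) (138240/152881) = (1/5) * Real.sqrt 2 * Real.sqrt 3 * (5:ℝ) ^ ((1:ℝ)/6) * (17:ℝ) ^ ((1:ℝ)/12) * (23:ℝ) ^ ((1:ℝ)/12) := by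
  obtain ⟨p, q, h, h0, h1⟩ := exists_pq
  have hp := p_eq h0 h1
  have s3 : Real.sqrt 3 ^ 2 = 3 := Real.sq_sqrt (by norm_num)
  have s2 : Real.sqrt 2 ^ 2 = 2 := Real.sq_sqrt (by norm_num)
  have s3p : 0 < Real.sqrt 3 := by positivity
  have pp : 0 < p := by
    have := bet_cos_pos
    rw [hp] at this
    exact pos_of_mul_pos_left this (by positivity)
  have p2 : p ^ 2 = 6/5 := by
    have := bet_cos
    rw [hp] at this
    have h4 : p ^ 2 * (Real.sqrt 3 ^ 2 / 4) = 9/10 := by linear_combination this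
    rw [s3] at h4
    linarith
  have hs := Real.rpow_pos_of_pos (show (0:ℝ) < 1564 by norm_num) (-2 * (1/24) : ℝ)
  have ht := Real.rpow_pos_of_pos (show (0:ℝ) < 2500 by norm_num) (-2 * (1/24) : ℝ)
  have hs12 := rp (show (0:ℝ) < 1564 by norm_num) (-2 * (1/24)) 12 (-1) (by norm_num)
  have ht12 := rp (show (0:ℝ) < 2500 by norm_num) (-2 * (1/24)) 12 (-1) (by norm_num)
  have a5 := rp (show (0:ℝ) < 5 by norm_num) (1/6) 12 2 (by norm_num)
  have a17 := rp (show (0:ℝ) < 17 by norm_num) (1/12) 12 1 (by norm_num)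
  have a23 := rp (show (0:ℝ) < 23 by norm_num) (1/12) 12 1 (by norm_num)
  rw [Real.rpow_neg_one] at hs12 ht12
  rw [Real.rpow_one] at a17 a23
  rw [show (5:ℝ) ^ (2:ℝ) = 25 by norm_num] at a5
  set w := twoFone (1/24) (13/24) (5/6) (138240/152881)
  have wp : 0 < w := by
    have : 0 < (1564:ℝ) ^ (-2 * (1/24) : ℝ) * w := by rw [h]; positivity
    exact pos_of_mul_pos_right this hs.le
  have hw : w ^ 12 * (1564)⁻¹ = (p ^ 2) ^ 6 * (2500)⁻¹ := by
    have := congrArg (fun x => x ^ 12) h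
    simp only [mul_pow, hs12, ht12] at this
    linear_combination this
  refine (pow_left_inj₀ (n := 12) wp.le (by positivity) (by norm_num)).1 ?_
  have s212 : Real.sqrt 2 ^ 12 = 2 ^ 6 := by rw [show Real.sqrt 2 ^ 12 = (Real.sqrt 2 ^ 2) ^ 6 by ring, s2]
  have s312 : Real.sqrt 3 ^ 12 = 3 ^ 6 := by rw [show Real.sqrt 3 ^ 12 = (Real.sqrt 3 ^ 2) ^ 6 by ring, s3]
  simp only [mul_pow, a5, a17, a23, s212, s312]
  rw [p2] at hw
  linarith
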